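/- For every integer q and every real s with 1 < s ≤ q, let α be a solution to OPT_q(s) such that SUPP_q(α) contains no induced copy of 3K_1 (i.e., there are no three sets in the support of α which pairwise intersect). Then SUPP_q(α) contains no induced matching of size two; that is, there do not exist four distinct sets A, B, C, D in the support of α with A ∩ C = ∅ and B ∩ D = ∅ while A ∩ B, B ∩ C, C ∩ D, and D ∩ A are all nonempty. -/

import Mathlib

/-- The nonempty subsets of `[q] = Fin q`, indexing the coordinates of our vectors. -/
def NEsets (q : ℕ) : Finset (Finset (Fin q)) :=
  Finset.univ.filter (fun A => A.Nonempty)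

/-- The objective function `OBJ_q(α) = Σ_{A ≠ ∅} α_A log |A|`. -/
noncomputable def objQ (q : ℕ) (α : Finset (Fin q) → ℝ) : ℝ :=
  ∑ A ∈ NEsets q, α A * Real.log (A.card : ℝ)

/-- The constraint function `V_q(α) = Σ_{A ≠ ∅} α_A`. -/
noncomputable def vQ (q : ℕ) (α : Finset (Fin q) → ℝ) : ℝ :=
  ∑ A ∈ NEsets q, α A

/-- The constraint function `E_q(α) = Σ_{{A,B} : A ∩ B = ∅} α_A α_B`, the sum being
over unordered pairs of disjoint nonempty sets. -/
noncomputable def eQ (q : ℕ) (α : Finset (Fin q) → ℝ) : ℝ :=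
  (1 / 2) * ∑ A ∈ NEsets q, ∑ B ∈ NEsets q,
    if Disjoint A B then α A * α B else 0

/-- The feasible set `FEAS_q(s)`: nonnegative vectors (indexed by nonempty subsets of
`[q]`, so the coordinate at `∅` is normalized to `0`) with `V_q(α) = 1` and
`E_q(α) ≥ (s-1)/(2s)`. -/
def Feas (q : ℕ) (s : ℝ) (α : Finset (Fin q) → ℝ) : Prop :=
  α ∅ = 0 ∧ (∀ A, 0 ≤ α A) ∧ vQ q α = 1 ∧ (s - 1) / (2 * s) ≤ eQ q α

/-- `α` is a solution to `OPT_q(s)`: it is feasible and maximizes `OBJ_q` over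
`FEAS_q(s)`. -/
def IsSolution (q : ℕ) (s : ℝ) (α : Finset (Fin q) → ℝ) : Prop :=
  Feas q s α ∧ ∀ β, Feas q s β → objQ q β ≤ objQ q α

/-- The support of `α`: the nonempty sets `A ⊆ [q]` with `α_A > 0`. -/
noncomputable def supp (q : ℕ) (α : Finset (Fin q) → ℝ) : Finset (Finset (Fin q)) :=
  @Finset.filter _ (fun A => 0 < α A) (Classical.decPred _) (NEsets q)

/-- `P` is a partition of `[q]` into nonempty parts. -/
def IsPartitionOf (q : ℕ) (P : Finset (Finset (Fin q))) : Prop :=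
  (∀ A ∈ P, A.Nonempty) ∧ (∀ A ∈ P, ∀ B ∈ P, A ≠ B → Disjoint A B) ∧
    P.biUnion id = Finset.univ

/-- `SUPP_q(α)` is in class `P_k`: the support of `α` is a partition of `[q]`
into `k` nonempty sets. -/
def ClassP (q k : ℕ) (α : Finset (Fin q) → ℝ) : Prop :=
  IsPartitionOf q (supp q α) ∧ (supp q α).card = k

/-- `SUPP_q(α)` is in class `Q_k`: the support of `α` consists of a partition
`A₁, …, A_k` of `[q]` into `k` nonempty sets together with the set `A₁ ∪ A₂`. -/
def ClassQ (q k : ℕ) (α : Finset (Fin q) → ℝ) : Prop :=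
  ∃ P : Finset (Finset (Fin q)), ∃ A₁ ∈ P, ∃ A₂ ∈ P, A₁ ≠ A₂ ∧
    IsPartitionOf q P ∧ P.card = k ∧ supp q α = insert (A₁ ∪ A₂) P

open Filter Topology

/-- The bilinear form of the disjointness graph on the nonempty subsets of `[q]`. -/
noncomputable def disjForm (q : ℕ) : LinearMap.BilinForm ℝ (Finset (Fin q) → ℝ) :=
  Matrix.toBilin' (Matrix.of fun A B : Finset (Fin q) =>
    if A.Nonempty ∧ B.Nonempty ∧ Disjoint A B then (1 : ℝ) else 0)

section Linear

variable {q : ℕ}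

lemma disjForm_single (A B : Finset (Fin q)) :
    disjForm q (Pi.single A 1) (Pi.single B 1) =
      if A.Nonempty ∧ B.Nonempty ∧ Disjoint A B then (1 : ℝ) else 0 := by
  simp [disjForm, Matrix.toBilin'_single]

lemma disjForm_comm (u v : Finset (Fin q) → ℝ) : disjForm q u v = disjForm q v u := by
  simp only [disjForm, Matrix.toBilin'_apply, Matrix.of_apply]
  rw [Finset.sum_comm]
  refine Finset.sum_congr rfl fun A _ => Finset.sum_congr rfl fun B _ => ?_
  have h : (B.Nonempty ∧ A.Nonempty ∧ Disjoint B A) ↔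
      (A.Nonempty ∧ B.Nonempty ∧ Disjoint A B) := by
    rw [disjoint_comm]; tauto
  simp only [h]
  ring

lemma disjForm_single_left {A : Finset (Fin q)} (hA : A.Nonempty) (v : Finset (Fin q) → ℝ) :
    disjForm q (Pi.single A 1) v = ∑ B ∈ NEsets q, if Disjoint A B then v B else 0 := by
  rw [disjForm, Matrix.toBilin'_apply', single_one_dotProduct]
  simp only [Matrix.mulVec, dotProduct, Matrix.of_apply, NEsets, Finset.sum_filter]
  refine Finset.sum_congr rfl fun B _ => ?_
  by_cases h1 : B.Nonempty <;> by_cases h2 : Disjoint A B <;> simp [h1, h2, hA]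

lemma eQ_eq_disjForm (v : Finset (Fin q) → ℝ) : eQ q v = (1 / 2) * disjForm q v v := by
  simp only [eQ, disjForm, Matrix.toBilin'_apply, Matrix.of_apply, NEsets, Finset.sum_filter]
  congr 1
  refine Finset.sum_congr rfl fun A _ => ?_
  by_cases h : A.Nonempty
  · rw [if_pos h]
    refine Finset.sum_congr rfl fun B _ => ?_
    by_cases h1 : B.Nonempty <;> by_cases h2 : Disjoint A B <;> simp [h1, h2, h]
  · simp [h]

lemma eQ_add_smul (u v : Finset (Fin q) → ℝ) (c : ℝ) :
    eQ q (u + c • v) = eQ q u + c * disjForm q v u + c ^ 2 * eQ q v := by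
  simp only [eQ_eq_disjForm, map_add, map_smul, LinearMap.add_apply, LinearMap.smul_apply,
    smul_eq_mul, disjForm_comm u v]
  ring

lemma objQ_add (u v : Finset (Fin q) → ℝ) : objQ q (u + v) = objQ q u + objQ q v := by
  simp [objQ, add_mul, Finset.sum_add_distrib]

lemma objQ_smul (c : ℝ) (v : Finset (Fin q) → ℝ) : objQ q (c • v) = c * objQ q v := by
  simp [objQ, Finset.mul_sum, mul_assoc]

lemma vQ_add (u v : Finset (Fin q) → ℝ) : vQ q (u + v) = vQ q u + vQ q v := by
  simp [vQ, Finset.sum_add_distrib]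

lemma vQ_smul (c : ℝ) (v : Finset (Fin q) → ℝ) : vQ q (c • v) = c * vQ q v := by
  simp [vQ, Finset.mul_sum]

lemma objQ_single {A : Finset (Fin q)} (hA : A.Nonempty) :
    objQ q (Pi.single A 1) = Real.log A.card := by
  simp [objQ, NEsets, Pi.single_apply, Finset.sum_ite_eq', hA]

lemma vQ_single {A : Finset (Fin q)} (hA : A.Nonempty) : vQ q (Pi.single A 1) = 1 := by
  simp [vQ, NEsets, Pi.single_apply, Finset.sum_ite_eq', hA]

lemma mem_supp {α : Finset (Fin q) → ℝ} {A : Finset (Fin q)} :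
    A ∈ supp q α ↔ A.Nonempty ∧ 0 < α A := by
  simp [supp, NEsets]

end Linear

section Optimality

variable {q : ℕ} {s : ℝ} {α : Finset (Fin q) → ℝ}

lemma eventually_nonneg_add_smul (hα : ∀ A, 0 ≤ α A) {v : Finset (Fin q) → ℝ}
    (hv : ∀ A, α A = 0 → 0 ≤ v A) : ∀ᶠ ε in 𝓝[>] (0 : ℝ), ∀ A, 0 ≤ (α + ε • v) A := by
  rw [eventually_all]
  intro A
  rcases (hα A).eq_or_lt with h | h
  · filter_upwards [self_mem_nhdsWithin] with ε hε
    simpa [← h] using mul_nonneg (le_of_lt hε) (hv A h.symm)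
  · have hc : Continuous fun ε : ℝ => (α + ε • v) A := by
      simp only [Pi.add_apply, Pi.smul_apply, smul_eq_mul]; fun_prop
    have := (hc.tendsto 0).eventually_const_lt (u := 0) (by simpa using h)
    filter_upwards [nhdsWithin_le_nhds this] with ε hε using hε.le

/-- First order optimality: a feasible direction that creates no deficit in the constraint `E`
does not increase the objective. -/
lemma objQ_nonpos_of_slack_or_pos (hα : IsSolution q s α) {v : Finset (Fin q) → ℝ}
    (h0 : v ∅ = 0) (hv : ∀ A, α A = 0 → 0 ≤ v A) (hV : vQ q v = 0)
    (hE : (s - 1) / (2 * s) < eQ q α ∨ 0 < disjForm q v α) : objQ q v ≤ 0 := by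
  obtain ⟨⟨hα0, hαn, hαV, hαE⟩, hmax⟩ := hα
  have hev : ∀ᶠ ε in 𝓝[>] (0 : ℝ), (s - 1) / (2 * s) ≤ eQ q (α + ε • v) := by
    simp only [eQ_add_smul]
    rcases hE with hE | hE
    · have hc : Continuous fun ε : ℝ => eQ q α + ε * disjForm q v α + ε ^ 2 * eQ q v := by
        fun_prop
      have := (hc.tendsto 0).eventually_const_lt (u := (s - 1) / (2 * s))
        (by simpa using hE)
      filter_upwards [nhdsWithin_le_nhds this] with ε hε using hε.le
    · have hc : Continuous fun ε : ℝ => disjForm q v α + ε * eQ q v := by fun_prop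
      have := (hc.tendsto 0).eventually_const_lt (u := 0) (by simpa using hE)
      filter_upwards [nhdsWithin_le_nhds this, self_mem_nhdsWithin] with ε hε hpos
      nlinarith [mul_pos hpos hε]
  obtain ⟨ε, hn, hE', hpos⟩ := ((eventually_nonneg_add_smul hαn hv).and
    (hev.and self_mem_nhdsWithin)).exists
  have hle := hmax (α + ε • v)
    ⟨by simp [hα0, h0], hn, by rw [vQ_add, vQ_smul, hV, hαV]; ring, hE'⟩
  rw [objQ_add, objQ_smul] at hle
  have hpos' : 0 < ε := hpos
  by_contra! h
  nlinarith [mul_pos hpos' h]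

lemma objQ_nonpos_of_disjForm_nonneg (hα : IsSolution q s α) {v w : Finset (Fin q) → ℝ}
    (hv0 : v ∅ = 0) (hv : ∀ A, α A = 0 → 0 ≤ v A) (hvV : vQ q v = 0)
    (hw0 : w ∅ = 0) (hw : ∀ A, α A = 0 → 0 ≤ w A) (hwV : vQ q w = 0)
    (hvE : 0 ≤ disjForm q v α) (hwE : 0 < disjForm q w α) : objQ q v ≤ 0 := by
  have key : ∀ δ : ℝ, 0 < δ → objQ q v + δ * objQ q w ≤ 0 := by
    intro δ hδ
    rw [← objQ_smul, ← objQ_add]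
    refine objQ_nonpos_of_slack_or_pos hα (by simp [hv0, hw0]) (fun A hA => ?_)
      (by rw [vQ_add, vQ_smul, hvV, hwV]; ring) (Or.inr ?_)
    · simpa using add_nonneg (hv A hA) (mul_nonneg hδ.le (hw A hA))
    · simpa using add_pos_of_nonneg_of_pos hvE (mul_pos hδ hwE)
  have hc : Continuous fun δ : ℝ => objQ q v + δ * objQ q w := by fun_prop
  have ht : Tendsto (fun δ : ℝ => objQ q v + δ * objQ q w) (𝓝[>] 0) (𝓝 (objQ q v)) := by
    simpa using (hc.tendsto 0).mono_left nhdsWithin_le_nhds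
  refine le_of_tendsto ht ?_
  filter_upwards [self_mem_nhdsWithin] with δ hδ using key δ hδ

/-- Second order optimality: the form `E` is not positive on the directions within the support
that preserve the total weight and the objective. -/
lemma eQ_nonpos_of_direction (hα : IsSolution q s α) {C : Finset (Fin q)} (hC : C ∈ supp q α)
    (hCuniv : C ≠ Finset.univ) {v : Finset (Fin q) → ℝ} (hv0 : v ∅ = 0)
    (hv : ∀ A, α A = 0 → v A = 0) (hV : vQ q v = 0) (hO : objQ q v = 0) : eQ q v ≤ 0 := by
  by_contra! hpos
  wlog hE : 0 ≤ disjForm q v α generalizing v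
  · refine this (v := -v) (by simp [hv0]) (fun A hA => by simp [hv A hA]) ?_ ?_ ?_ ?_
    · simpa [hV] using vQ_smul (-1) v
    · simpa [hO] using objQ_smul (-1) v
    · simpa [eQ_eq_disjForm] using hpos
    · simpa using (not_le.mp hE).le
  obtain ⟨hCne, hCpos⟩ := mem_supp.mp hC
  have hcont : Continuous fun ε : ℝ => (α + ε • v) C := by
    simp only [Pi.add_apply, Pi.smul_apply, smul_eq_mul]; fun_prop
  have hCev := (hcont.tendsto 0).eventually_const_lt (u := 0) (by simpa using hCpos)
  obtain ⟨ε, ⟨hn, hCε⟩, hε⟩ := (((eventually_nonneg_add_smul hα.1.2.1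
    fun A hA => (hv A hA).ge).and (nhdsWithin_le_nhds hCev)).and self_mem_nhdsWithin).exists
  have hε' : 0 < ε := hε
  have hslack : (s - 1) / (2 * s) < eQ q (α + ε • v) := by
    rw [eQ_add_smul]
    have h1 := hα.1.2.2.2
    have h2 := mul_nonneg hε'.le hE
    have h3 := mul_pos (pow_pos hε' 2) hpos
    linarith
  have hsol : IsSolution q s (α + ε • v) := by
    refine ⟨⟨by simp [hα.1.1, hv0], hn, ?_, hslack.le⟩, fun β hβ => ?_⟩
    · rw [vQ_add, vQ_smul, hV, hα.1.2.2.1]; ring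
    · rw [objQ_add, objQ_smul, hO]
      simpa using hα.2 β hβ
  have huniv : (Finset.univ : Finset (Fin q)).Nonempty := hCne.mono (Finset.subset_univ _)
  have hle := objQ_nonpos_of_slack_or_pos hsol
    (v := Pi.single Finset.univ 1 + (-1 : ℝ) • Pi.single C 1)
    (by simp [huniv.ne_empty.symm, hCne.ne_empty.symm])
    (fun A hA => by
      have hAC : A ≠ C := by rintro rfl; exact hCε.ne' hA
      by_cases h : A = Finset.univ <;> simp [h, hAC, hCuniv.symm])
    (by rw [vQ_add, vQ_smul, vQ_single huniv, vQ_single hCne]; ring) (Or.inl hslack)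
  rw [objQ_add, objQ_smul, objQ_single huniv, objQ_single hCne] at hle
  have hcard : C.card < (Finset.univ : Finset (Fin q)).card :=
    Finset.card_lt_card (Finset.ssubset_univ_iff.mpr hCuniv)
  have := Real.log_lt_log (by exact_mod_cast hCne.card_pos : (0 : ℝ) < C.card)
    (by exact_mod_cast hcard : (C.card : ℝ) < (Finset.univ : Finset (Fin q)).card)
  linarith

end Optimality

/-- No three distinct sets in the support of `α` are pairwise intersecting. -/
def NoIntersectingTriple (q : ℕ) (α : Finset (Fin q) → ℝ) : Prop :=
  ¬ ∃ A B C : Finset (Fin q), A ∈ supp q α ∧ B ∈ supp q α ∧ C ∈ supp q α ∧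
    A ≠ B ∧ A ≠ C ∧ B ≠ C ∧ (A ∩ B).Nonempty ∧ (A ∩ C).Nonempty ∧ (B ∩ C).Nonempty

/-- `AC` and `BD` form an induced matching in the support graph of `α`. -/
structure InducedMatching (q : ℕ) (α : Finset (Fin q) → ℝ) (A B C D : Finset (Fin q)) :
    Prop where
  memA : A ∈ supp q α
  memB : B ∈ supp q α
  memC : C ∈ supp q α
  memD : D ∈ supp q α
  disjAC : Disjoint A C
  disjBD : Disjoint B D
  interAB : (A ∩ B).Nonempty
  interBC : (B ∩ C).Nonempty
  interCD : (C ∩ D).Nonempty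
  interDA : (D ∩ A).Nonempty

namespace InducedMatching

variable {q : ℕ} {s : ℝ} {α : Finset (Fin q) → ℝ} {A B C D : Finset (Fin q)}

lemma rotate (h : InducedMatching q α A B C D) : InducedMatching q α B C D A :=
  ⟨h.memB, h.memC, h.memD, h.memA, h.disjBD, h.disjAC.symm, h.interBC, h.interCD, h.interDA,
    h.interAB⟩

lemma reflect (h : InducedMatching q α A B C D) : InducedMatching q α A D C B :=
  ⟨h.memA, h.memD, h.memC, h.memB, h.disjAC, h.disjBD.symm,
    by simpa only [Finset.inter_comm] using h.interDA,
    by simpa only [Finset.inter_comm] using h.interCD,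
    by simpa only [Finset.inter_comm] using h.interBC,
    by simpa only [Finset.inter_comm] using h.interAB⟩

lemma sdiff_nonempty (h : InducedMatching q α A B C D) : (B \ C).Nonempty := by
  obtain ⟨x, hx⟩ := h.interAB
  rw [Finset.mem_inter] at hx
  exact ⟨x, Finset.mem_sdiff.mpr ⟨hx.2, Finset.disjoint_left.mp h.disjAC hx.1⟩⟩

lemma disjForm_sdiff (h : InducedMatching q α A B C D) (hα : ∀ A, 0 ≤ α A) :
    disjForm q (Pi.single B 1) α + α C ≤ disjForm q (Pi.single (B \ C) 1) α := by
  obtain ⟨hB, -⟩ := mem_supp.mp h.memB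
  obtain ⟨hC, -⟩ := mem_supp.mp h.memC
  have hαC : α C = ∑ Y ∈ NEsets q, if C = Y then α Y else 0 := by
    simp [NEsets, hC]
  rw [disjForm_single_left hB, disjForm_single_left h.sdiff_nonempty, hαC,
    ← Finset.sum_add_distrib]
  refine Finset.sum_le_sum fun Y _ => ?_
  by_cases hY : C = Y
  · subst hY
    have : ¬ Disjoint B C := Finset.not_disjoint_iff_nonempty_inter.mpr h.interBC
    simp [this, Finset.sdiff_disjoint]
  · by_cases hBY : Disjoint B Y
    · simp [hY, hBY, hBY.mono_left Finset.sdiff_subset]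
    · simp only [hBY, hY, if_false, add_zero]
      split_ifs
      exacts [hα Y, le_rfl]

lemma disjForm_union (h : InducedMatching q α A B C D) (hα : ∀ A, 0 ≤ α A)
    (h3 : NoIntersectingTriple q α) :
    disjForm q (Pi.single A 1) α ≤ disjForm q (Pi.single (A ∪ (C ∩ (B ∪ D))) 1) α + α C := by
  obtain ⟨hA, -⟩ := mem_supp.mp h.memA
  obtain ⟨hC, -⟩ := mem_supp.mp h.memC
  have hαC : α C = ∑ Y ∈ NEsets q, if C = Y then α Y else 0 := by
    simp [NEsets, hC]
  rw [disjForm_single_left hA, disjForm_single_left (hA.mono Finset.subset_union_left), hαC,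
    ← Finset.sum_add_distrib]
  refine Finset.sum_le_sum fun Y hYne => ?_
  have hYne : Y.Nonempty := by simpa [NEsets] using hYne
  by_cases hAY : Disjoint A Y
  swap
  · rw [if_neg hAY]
    refine add_nonneg ?_ ?_ <;> split_ifs <;> first | exact hα Y | exact le_rfl
  rw [if_pos hAY]
  by_cases hCY : C = Y
  · rw [if_pos hCY]
    split_ifs <;> linarith [hα Y]
  rw [if_neg hCY, add_zero]
  split_ifs with hd
  · exact le_rfl
  by_contra! hpos
  rw [Finset.disjoint_union_left] at hd
  obtain ⟨x, hx, hxY⟩ := Finset.not_disjoint_iff.mp fun h' => hd ⟨hAY, h'⟩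
  have hYs : Y ∈ supp q α := mem_supp.mpr ⟨hYne, hpos⟩
  rw [Finset.mem_inter, Finset.mem_union] at hx
  obtain ⟨hxC, hxB | hxD⟩ := hx
  · refine h3 ⟨Y, B, C, hYs, h.memB, h.memC, ?_, Ne.symm hCY, ?_, ⟨x, by simp [*]⟩,
      ⟨x, by simp [*]⟩, h.interBC⟩
    · rintro rfl
      exact Finset.not_disjoint_iff_nonempty_inter.mpr h.interAB hAY
    · rintro rfl
      exact Finset.not_disjoint_iff_nonempty_inter.mpr h.interAB h.disjAC
  · refine h3 ⟨Y, C, D, hYs, h.memC, h.memD, Ne.symm hCY, ?_, ?_, ⟨x, by simp [*]⟩,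
      ⟨x, by simp [*]⟩, h.interCD⟩
    · rintro rfl
      exact Finset.not_disjoint_iff_nonempty_inter.mpr h.interDA hAY.symm
    · rintro rfl
      exact Finset.not_disjoint_iff_nonempty_inter.mpr h.interDA h.disjAC.symm

/-- Shifting weight from `A` to `A ∪ (C ∩ (B ∪ D))` and equally from `B` to `B \ C` does not
increase the objective. -/
lemma card_mul_le (h : InducedMatching q α A B C D) (hα : IsSolution q s α)
    (h3 : NoIntersectingTriple q α) :
    ((A.card : ℝ) + (B ∩ C).card + (C ∩ D).card) * (B.card - (B ∩ C).card) ≤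
      A.card * B.card := by
  obtain ⟨hA, hApos⟩ := mem_supp.mp h.memA
  obtain ⟨hB, hBpos⟩ := mem_supp.mp h.memB
  obtain ⟨hC, hCpos⟩ := mem_supp.mp h.memC
  set X := A ∪ (C ∩ (B ∪ D)) with hXdef
  have hX : X.Nonempty := hA.mono Finset.subset_union_left
  have hBC := h.sdiff_nonempty
  have h1 := h.disjForm_sdiff hα.1.2.1
  have h2 := h.disjForm_union hα.1.2.1 h3
  have hnonneg : ∀ Z, α Z = 0 → Z ≠ A ∧ Z ≠ B := fun Z hZ =>
    ⟨fun e => hApos.ne' (e ▸ hZ), fun e => hBpos.ne' (e ▸ hZ)⟩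
  have hsingle : ∀ Y Z : Finset (Fin q), 0 ≤ (Pi.single Y 1 : Finset (Fin q) → ℝ) Z :=
    fun Y Z => by rw [Pi.single_apply]; split_ifs <;> norm_num
  have hle := objQ_nonpos_of_disjForm_nonneg hα
    (v := (Pi.single X 1 + (-1 : ℝ) • Pi.single A 1) +
      (Pi.single (B \ C) 1 + (-1 : ℝ) • Pi.single B 1))
    (w := Pi.single (B \ C) 1 + (-1 : ℝ) • Pi.single B 1)
    (by simp [hX.ne_empty.symm, hA.ne_empty.symm, hBC.ne_empty.symm,
      hB.ne_empty.symm])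
    (fun Z hZ => by
      have := hnonneg Z hZ
      simpa [this.1, this.2] using add_nonneg (hsingle X Z) (hsingle (B \ C) Z))
    (by simp only [vQ_add, vQ_smul, vQ_single hX, vQ_single hA, vQ_single hB, vQ_single hBC]
        ring)
    (by simp [hBC.ne_empty.symm, hB.ne_empty.symm])
    (fun Z hZ => by simpa [(hnonneg Z hZ).2] using hsingle (B \ C) Z)
    (by simp only [vQ_add, vQ_smul, vQ_single hB, vQ_single hBC]; ring)
    (by simp only [map_add, map_smul, LinearMap.add_apply, LinearMap.smul_apply, smul_eq_mul]
        linarith)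
    (by simp only [map_add, map_smul, LinearMap.add_apply, LinearMap.smul_apply, smul_eq_mul]
        linarith)
  simp only [objQ_add, objQ_smul, objQ_single hX, objQ_single hA, objQ_single hB,
    objQ_single hBC] at hle
  have hXcard : (X.card : ℝ) = A.card + (B ∩ C).card + (C ∩ D).card := by
    have e1 : X.card = A.card + (C ∩ (B ∪ D)).card :=
      Finset.card_union_of_disjoint (h.disjAC.mono_right Finset.inter_subset_left)
    have e2 : (C ∩ (B ∪ D)).card = (B ∩ C).card + (C ∩ D).card := by
      rw [Finset.inter_union_distrib_left, Finset.inter_comm B C]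
      exact Finset.card_union_of_disjoint (h.disjBD.mono Finset.inter_subset_right
        Finset.inter_subset_right)
    rw [e1, e2]; push_cast; ring
  have hBCcard : ((B \ C).card : ℝ) = B.card - (B ∩ C).card := by
    rw [eq_sub_iff_add_eq]
    exact_mod_cast Finset.card_sdiff_add_card_inter B C
  rw [← hXcard, ← hBCcard]
  have pos : ∀ {Z : Finset (Fin q)}, Z.Nonempty → (0 : ℝ) < Z.card := fun hZ => by
    exact_mod_cast hZ.card_pos
  rw [← Real.log_le_log_iff (mul_pos (pos hX) (pos hBC)) (mul_pos (pos hA) (pos hB)),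
    Real.log_mul (pos hX).ne' (pos hBC).ne', Real.log_mul (pos hA).ne' (pos hB).ne']
  linarith

lemma card_add_card_le (h : InducedMatching q α A B C D) (hα : IsSolution q s α)
    (h3 : NoIntersectingTriple q α) : (B.card : ℝ) + D.card ≤ A.card + C.card := by
  have h1 := h.card_mul_le hα h3
  have h2 := h.reflect.card_mul_le hα h3
  rw [Finset.inter_comm D C, Finset.inter_comm C B] at h2
  have hy : (0 : ℝ) < (B ∩ C).card := by exact_mod_cast h.interBC.card_pos
  have hz : (0 : ℝ) < (C ∩ D).card := by exact_mod_cast h.interCD.card_pos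
  have hC : ((B ∩ C).card : ℝ) + (C ∩ D).card ≤ C.card := by
    rw [Finset.inter_comm B C]
    have := Finset.card_union_of_disjoint (s := C ∩ B) (t := C ∩ D)
      (h.disjBD.mono Finset.inter_subset_right Finset.inter_subset_right)
    exact_mod_cast this ▸ Finset.card_le_card
      (Finset.union_subset Finset.inter_subset_left Finset.inter_subset_left)
  refine le_trans ?_ (add_le_add_right hC _)
  refine le_of_mul_le_mul_left ?_ (add_pos hy hz)
  nlinarith

/-- An objective-preserving direction on the support along which `E` has positive curvature is
impossible. -/
lemma false_of_card_le (h : InducedMatching q α A B C D) (hα : IsSolution q s α)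
    (hcard : (A.card : ℝ) + C.card = B.card + D.card) (hBA : B.card ≤ A.card)
    (hDB : D.card ≤ B.card) : False := by
  obtain ⟨hA, hApos⟩ := mem_supp.mp h.memA
  obtain ⟨hB, hBpos⟩ := mem_supp.mp h.memB
  obtain ⟨hC, hCpos⟩ := mem_supp.mp h.memC
  obtain ⟨hD, hDpos⟩ := mem_supp.mp h.memD
  have pos : ∀ {Z : Finset (Fin q)}, Z.Nonempty → (0 : ℝ) < Z.card := fun hZ => by
    exact_mod_cast hZ.card_pos
  have hBA' : (B.card : ℝ) ≤ A.card := by exact_mod_cast hBA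
  have hDB' : (D.card : ℝ) ≤ B.card := by exact_mod_cast hDB
  have hlow : Real.log A.card + Real.log C.card ≤ Real.log B.card + Real.log D.card := by
    rw [← Real.log_mul (pos hA).ne' (pos hC).ne', ← Real.log_mul (pos hB).ne' (pos hD).ne']
    refine Real.log_le_log (mul_pos (pos hA) (pos hC)) ?_
    have : (C.card : ℝ) = B.card + D.card - A.card := by linarith
    rw [this]
    nlinarith [mul_nonneg (sub_nonneg.mpr hBA') (sub_nonneg.mpr (hDB'.trans hBA'))]
  have hB_le := Real.log_le_log (pos hB) hBA'
  have hD_le := Real.log_le_log (pos hD) (hDB'.trans hBA')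
  obtain ⟨t, ht0, ht1, ht⟩ : ∃ t : ℝ, 0 ≤ t ∧ t ≤ 1 ∧
      t * (Real.log A.card - Real.log C.card) =
        Real.log B.card + Real.log D.card - Real.log A.card - Real.log C.card := by
    have hCA : Real.log C.card ≤ Real.log A.card :=
      Real.log_le_log (pos hC) (by linarith)
    rcases hCA.eq_or_lt with e | e
    · exact ⟨0, le_rfl, zero_le_one, by linarith⟩
    · have e' := sub_pos.mpr e
      refine ⟨(Real.log B.card + Real.log D.card - Real.log A.card - Real.log C.card) /
        (Real.log A.card - Real.log C.card), div_nonneg (by linarith) e'.le,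
        (div_le_one e').mpr (by linarith), div_mul_cancel₀ _ e'.ne'⟩
  have hCuniv : C ≠ Finset.univ := by
    rintro rfl
    exact hA.ne_empty (by simpa using Finset.disjoint_iff_inter_eq_empty.mp h.disjAC)
  have hle := eQ_nonpos_of_direction hα h.memC hCuniv
    (v := ((1 + t) • Pi.single A 1 + (1 - t) • Pi.single C 1) +
      ((-1 : ℝ) • Pi.single B 1 + (-1 : ℝ) • Pi.single D 1))
    (by simp [hA.ne_empty.symm, hB.ne_empty.symm, hC.ne_empty.symm,
      hD.ne_empty.symm])
    (fun Z hZ => by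
      have hZA : Z ≠ A := fun e => hApos.ne' (e ▸ hZ)
      have hZB : Z ≠ B := fun e => hBpos.ne' (e ▸ hZ)
      have hZC : Z ≠ C := fun e => hCpos.ne' (e ▸ hZ)
      have hZD : Z ≠ D := fun e => hDpos.ne' (e ▸ hZ)
      simp [hZA, hZB, hZC, hZD])
    (by simp only [vQ_add, vQ_smul, vQ_single hA, vQ_single hB, vQ_single hC, vQ_single hD]
        ring)
    (by simp only [objQ_add, objQ_smul, objQ_single hA, objQ_single hB, objQ_single hC,
          objQ_single hD]
        linarith)
  have nAB := Finset.not_disjoint_iff_nonempty_inter.mpr h.interAB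
  have nBC := Finset.not_disjoint_iff_nonempty_inter.mpr h.interBC
  have nCD := Finset.not_disjoint_iff_nonempty_inter.mpr h.interCD
  have nDA := Finset.not_disjoint_iff_nonempty_inter.mpr h.interDA
  have nBA := mt (@Disjoint.symm _ _ _ B A) nAB
  have nCB := mt (@Disjoint.symm _ _ _ C B) nBC
  have nDC := mt (@Disjoint.symm _ _ _ D C) nCD
  have nAD := mt (@Disjoint.symm _ _ _ A D) nDA
  simp only [eQ_eq_disjForm, map_add, map_smul, LinearMap.add_apply, LinearMap.smul_apply,
    smul_eq_mul, disjForm_single, hA, hB, hC, hD, h.disjAC, h.disjAC.symm, h.disjBD,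
    h.disjBD.symm, nAB, nBC, nCD, nDA, nBA, nCB, nDC, nAD, disjoint_self, Finset.bot_eq_empty,
    hA.ne_empty, hB.ne_empty, hC.ne_empty, hD.ne_empty, and_true, and_false, if_true,
    if_false] at hle
  nlinarith

lemma not_isSolution (h : InducedMatching q α A B C D) (h3 : NoIntersectingTriple q α) :
    ¬ IsSolution q s α := by
  intro hα
  have h1 := h.card_add_card_le hα h3
  have h2 := h.rotate.card_add_card_le hα h3
  have hcard : (A.card : ℝ) + C.card = B.card + D.card := by linarith
  clear h1 h2
  wlog hCA : C.card ≤ A.card generalizing A B C D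
  · exact this h.rotate.rotate (by linarith) (by omega)
  wlog hDB : D.card ≤ B.card generalizing B D
  · exact this h.reflect (by linarith) (by omega)
  rcases le_total B.card A.card with hBA | hAB
  · exact h.false_of_card_le hα hcard hBA hDB
  · exact h.rotate.reflect.false_of_card_le hα (by linarith) (by omega) (by omega)

end InducedMatching

/-- If a solution `α` to `OPT_q(s)` has no three distinct pairwise-intersecting sets in
its support (no induced `3K_1`), then there is no induced matching of size two: no four
distinct support sets `A, B, C, D` with `A ∩ C = ∅`, `B ∩ D = ∅` and `A ∩ B`, `B ∩ C`,
`C ∩ D`, `D ∩ A` all nonempty. -/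
theorem no_induced_matching (q : ℕ) (s : ℝ) (hs : 1 < s) (hsq : s ≤ q)
    (α : Finset (Fin q) → ℝ) (hα : IsSolution q s α)
    (h3K1 : ¬ ∃ A B C : Finset (Fin q),
      A ∈ supp q α ∧ B ∈ supp q α ∧ C ∈ supp q α ∧
      A ≠ B ∧ A ≠ C ∧ B ≠ C ∧
      (A ∩ B).Nonempty ∧ (A ∩ C).Nonempty ∧ (B ∩ C).Nonempty) :
    ¬ ∃ A B C D : Finset (Fin q),
      A ∈ supp q α ∧ B ∈ supp q α ∧ C ∈ supp q α ∧ D ∈ supp q α ∧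
      A ≠ B ∧ A ≠ C ∧ A ≠ D ∧ B ≠ C ∧ B ≠ D ∧ C ≠ D ∧
      A ∩ C = ∅ ∧ B ∩ D = ∅ ∧
      (A ∩ B).Nonempty ∧ (B ∩ C).Nonempty ∧ (C ∩ D).Nonempty ∧
      (D ∩ A).Nonempty := by
  rintro ⟨A, B, C, D, hA, hB, hC, hD, -, -, -, -, -, -, hAC, hBD, hAB, hBC, hCD, hDA⟩
  exact InducedMatching.not_isSolution ⟨hA, hB, hC, hD, Finset.disjoint_iff_inter_eq_empty.mpr hAC,
    Finset.disjoint_iff_inter_eq_empty.mpr hBD, hAB, hBC, hCD, hDA⟩ h3K1 hα
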